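/- Let n and k be integers with 2 ≤ k ≤ n−3. Then G_3 is the unique second last graph in the S-order among 𝒢_n^k; that is, G_3 ≺_s K_n^k, and every connected n-vertex graph G with exactly k cut edges that is isomorphic to neither K_n^k nor G_3 satisfies G ≺_s G_3. -/

import Mathlib

open SimpleGraph

/-- The `k`-th spectral moment of a graph: the trace of the `k`-th power of its
adjacency matrix. -/
noncomputable def specMoment {V : Type*} [Fintype V] (G : SimpleGraph V) (k : ℕ) : ℝ :=
  letI := Classical.decEq V
  letI : DecidableRel G.Adj := Classical.decRel _
  Matrix.trace ((G.adjMatrix ℝ) ^ k)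

/-- The strict lexicographic order by spectral moments (`S`-order) for graphs on
`n` vertices. -/
def SLt {V W : Type*} [Fintype V] [Fintype W] (n : ℕ)
    (G : SimpleGraph V) (H : SimpleGraph W) : Prop :=
  ∃ k, 1 ≤ k ∧ k ≤ n - 1 ∧ (∀ i, i < k → specMoment G i = specMoment H i) ∧
    specMoment G k < specMoment H k

/-- The number of cut edges (bridges) of a graph. -/
noncomputable def numBridges {V : Type*} (G : SimpleGraph V) : ℕ :=
  {e : Sym2 V | G.IsBridge e}.ncard

/-- `KnK n k`: the `n`-vertex graph obtained from the complete graph `K_{n-k}`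
(on the first `n - k` vertices) by attaching `k` pendant vertices to the
vertex `0` of the clique. -/
def KnK (n k : ℕ) : SimpleGraph (Fin n) :=
  SimpleGraph.fromRel (fun i j =>
    ((i : ℕ) < n - k ∧ (j : ℕ) < n - k) ∨ ((i : ℕ) = 0 ∧ n - k ≤ (j : ℕ)))

/-- `GThree n k`: the graph obtained from `K_n^k` by deleting the cut edge between
the clique vertex `0` and the pendant vertex `n - 1`, and adding the edge between
the clique vertex `1` and the vertex `n - 1`. -/
def GThree (n k : ℕ) : SimpleGraph (Fin n) :=
  SimpleGraph.fromRel (fun i j =>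
    ((i : ℕ) < n - k ∧ (j : ℕ) < n - k) ∨
    ((i : ℕ) = 0 ∧ n - k ≤ (j : ℕ) ∧ (j : ℕ) < n - 1) ∨
    ((i : ℕ) = 1 ∧ (j : ℕ) = n - 1))

/-! ### Counting closed walks -/

open Classical in
/-- Adjacency indicator. -/
noncomputable def adjN {V : Type*} (G : SimpleGraph V) (u v : V) : ℕ := if G.Adj u v then 1 else 0

/-- Degree as a sum. -/
noncomputable def dg {V : Type*} [Fintype V] (G : SimpleGraph V) (v : V) : ℕ := ∑ w, adjN G v w

/-- Closed 3-walks. -/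
noncomputable def mThree {V : Type*} [Fintype V] (G : SimpleGraph V) : ℕ :=
  ∑ u, ∑ v, ∑ w, adjN G u v * adjN G v w * adjN G w u

/-- Closed 4-walks. -/
noncomputable def mFour {V : Type*} [Fintype V] (G : SimpleGraph V) : ℕ :=
  ∑ u, ∑ v, ∑ w, ∑ x, adjN G u v * adjN G v w * adjN G w x * adjN G x u

open Classical in
/-- Closed 4-walks that are genuine 4-cycles. -/
noncomputable def qFour {V : Type*} [Fintype V] (G : SimpleGraph V) : ℕ :=
  ∑ u, ∑ v, ∑ w, ∑ x, if u ≠ w ∧ v ≠ x then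
    adjN G u v * adjN G v w * adjN G w x * adjN G x u else 0

lemma adjN_congr {V W : Type*} {G : SimpleGraph V} {H : SimpleGraph W} {u v : V} {x y : W}
    (h : G.Adj u v ↔ H.Adj x y) : adjN G u v = adjN H x y := by
  by_cases a : G.Adj u v
  · simp [adjN, a, h.1 a]
  · simp [adjN, a, mt h.2 a]

lemma adjN_comm {V : Type*} (G : SimpleGraph V) (u v : V) : adjN G u v = adjN G v u :=
  adjN_congr (G.adj_comm u v)

lemma adjN_sq {V : Type*} (G : SimpleGraph V) (u v : V) : adjN G u v * adjN G u v = adjN G u v := by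
  unfold adjN; split_ifs <;> simp

open Classical in
lemma dg_eq_card {V : Type*} [Fintype V] (G : SimpleGraph V) (v : V) :
    dg G v = (Finset.univ.filter (fun w => G.Adj v w)).card := by
  simp [dg, adjN]

lemma spec_zero {V : Type*} [Fintype V] (G : SimpleGraph V) :
    specMoment G 0 = Fintype.card V := by
  simp [specMoment]

lemma spec_one {V : Type*} [Fintype V] (G : SimpleGraph V) : specMoment G 1 = 0 := by
  simp [specMoment]

lemma spec_two {V : Type*} [Fintype V] (G : SimpleGraph V) :
    specMoment G 2 = ((∑ v, dg G v : ℕ) : ℝ) := by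
  have h : ∀ u v, adjN G u v * adjN G v u = adjN G u v := by
    intro u v; rw [adjN_comm G v u, adjN_sq]
  simp only [specMoment, dg, Matrix.trace, pow_succ, pow_zero, one_mul, Matrix.diag_apply,
    Matrix.mul_apply, adjMatrix_apply]
  push_cast
  refine Finset.sum_congr rfl fun u _ => Finset.sum_congr rfl fun v _ => ?_
  rw [← h u v]; simp [adjN]

lemma spec_three {V : Type*} [Fintype V] (G : SimpleGraph V) :
    specMoment G 3 = (mThree G : ℝ) := by
  simp only [specMoment, mThree, Matrix.trace, pow_succ, pow_zero, one_mul, Matrix.diag_apply,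
    Matrix.mul_apply, adjMatrix_apply, Finset.sum_mul]
  push_cast
  refine Finset.sum_congr rfl fun u _ => ?_
  rw [Finset.sum_comm]
  refine Finset.sum_congr rfl fun v _ => Finset.sum_congr rfl fun w _ => ?_
  simp [adjN]

lemma spec_four {V : Type*} [Fintype V] (G : SimpleGraph V) :
    specMoment G 4 = (mFour G : ℝ) := by
  simp only [specMoment, mFour, Matrix.trace, pow_succ, pow_zero, one_mul, Matrix.diag_apply,
    Matrix.mul_apply, adjMatrix_apply, Finset.sum_mul]
  push_cast
  refine Finset.sum_congr rfl fun u _ => ?_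
  have this : ∀ f : V → V → V → ℝ, ∑ x, ∑ y, ∑ z, f x y z = ∑ z, ∑ y, ∑ x, f x y z := by
    intro f
    calc _ = ∑ y, ∑ x, ∑ z, f x y z := Finset.sum_comm
      _ = ∑ y, ∑ z, ∑ x, f x y z := Finset.sum_congr rfl fun y _ => Finset.sum_comm
      _ = _ := Finset.sum_comm
  rw [this]
  refine Finset.sum_congr rfl fun v _ => Finset.sum_congr rfl fun w _ =>
    Finset.sum_congr rfl fun x _ => ?_
  simp [adjN]

lemma mFour_eq {V : Type*} [Fintype V] (G : SimpleGraph V) :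
    mFour G + ∑ v, dg G v = 2 * ∑ v, dg G v ^ 2 + qFour G := by
  classical
  have h1 : ∑ v, dg G v ^ 2 = ∑ u, ∑ v, ∑ w, ∑ x, if u = w then
    adjN G u v * adjN G v w * adjN G w x * adjN G x u else 0 := by
    refine Finset.sum_congr rfl fun u _ => ?_
    rw [sq, dg, Finset.sum_mul]
    refine Finset.sum_congr rfl fun v _ => ?_
    rw [Finset.mul_sum, Finset.sum_comm]
    refine Finset.sum_congr rfl fun x _ => ?_
    rw [Finset.sum_ite_eq Finset.univ u]
    simp only [Finset.mem_univ, if_true]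
    rw [adjN_comm G v u, adjN_sq, adjN_comm G x u, mul_assoc, adjN_sq]
  have h2 : ∑ v, dg G v ^ 2 = ∑ u, ∑ v, ∑ w, ∑ x, if v = x then
    adjN G u v * adjN G v w * adjN G w x * adjN G x u else 0 := by
    rw [Finset.sum_comm]
    refine Finset.sum_congr rfl fun v _ => ?_
    rw [sq, dg, Finset.sum_mul]
    refine Finset.sum_congr rfl fun u _ => ?_
    rw [Finset.mul_sum]
    refine Finset.sum_congr rfl fun w _ => ?_
    rw [Finset.sum_ite_eq Finset.univ v]
    simp only [Finset.mem_univ, if_true]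
    rw [adjN_comm G w v, adjN_comm G u v, mul_assoc (adjN G v u), adjN_sq, mul_right_comm, adjN_sq]
  have h3 : ∑ v, dg G v = ∑ u, ∑ v, ∑ w, ∑ x, if u = w ∧ v = x then
    adjN G u v * adjN G v w * adjN G w x * adjN G x u else 0 := by
    refine Finset.sum_congr rfl fun u _ => ?_
    rw [dg]
    refine Finset.sum_congr rfl fun v _ => ?_
    simp only [ite_and]
    rw [Finset.sum_comm]
    simp only [Finset.sum_ite_eq, Finset.mem_univ, if_true]
    rw [adjN_comm G v u, adjN_sq, adjN_sq, adjN_sq]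
  rw [two_mul]
  nth_rw 1 [h1]
  rw [h2, h3, mFour, qFour]
  simp only [← Finset.sum_add_distrib]
  refine Finset.sum_congr rfl fun u _ => Finset.sum_congr rfl fun v _ =>
    Finset.sum_congr rfl fun w _ => Finset.sum_congr rfl fun x _ => ?_
  by_cases a : u = w <;> by_cases b : v = x <;> simp [a, b]

/-! ### Clique plus tree-like part -/

/-- `G` has clique `S`, and triangles and 4-cycles live in `S`. -/
structure CliqueCore {V : Type*} (G : SimpleGraph V) (S : Finset V) : Prop where
  clique : ∀ u ∈ S, ∀ v ∈ S, u ≠ v → G.Adj u v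
  tri : ∀ u v w, G.Adj u v → G.Adj v w → G.Adj w u → u ∈ S
  quad : ∀ u v w x, G.Adj u v → G.Adj v w → G.Adj w x → G.Adj x u → u ≠ w → v ≠ x → u ∈ S

/-- The complete graph on `S` plus isolated vertices. -/
def cliqueOn {V : Type*} (S : Finset V) : SimpleGraph V where
  Adj u v := u ≠ v ∧ u ∈ S ∧ v ∈ S
  symm := ⟨fun _ _ h => ⟨h.1.symm, h.2.2, h.2.1⟩⟩
  loopless := ⟨fun _ h => h.1 rfl⟩

lemma adjN_cliqueOn {V : Type*} {G : SimpleGraph V} {S : Finset V} (h : CliqueCore G S)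
    {u v : V} (hu : u ∈ S) (hv : v ∈ S) : adjN G u v = adjN (cliqueOn S) u v := by
  have : G.Adj u v ↔ (cliqueOn S).Adj u v :=
    ⟨fun a => ⟨a.ne, hu, hv⟩, fun a => h.clique u hu v hv a.1⟩
  exact adjN_congr this

lemma adjN_ne_zero {V : Type*} {G : SimpleGraph V} {u v : V} : adjN G u v ≠ 0 ↔ G.Adj u v := by
  simp [adjN]

lemma mThree_core {V : Type*} [Fintype V] {G : SimpleGraph V} {S : Finset V}
    (h : CliqueCore G S) : mThree G = mThree (cliqueOn S) := by
  refine Finset.sum_congr rfl fun u _ => Finset.sum_congr rfl fun v _ =>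
    Finset.sum_congr rfl fun w _ => ?_
  by_cases hS : u ∈ S ∧ v ∈ S ∧ w ∈ S
  · rw [adjN_cliqueOn h hS.1 hS.2.1, adjN_cliqueOn h hS.2.1 hS.2.2, adjN_cliqueOn h hS.2.2 hS.1]
  · have h1 : adjN G u v * adjN G v w * adjN G w u = 0 := by
      by_contra hne
      simp only [mul_eq_zero, not_or, ← ne_eq, adjN_ne_zero] at hne
      obtain ⟨⟨a, b⟩, c⟩ := hne
      exact hS ⟨h.tri _ _ _ a b c, h.tri _ _ _ b c a, h.tri _ _ _ c a b⟩
    have h2 : adjN (cliqueOn S) u v * adjN (cliqueOn S) v w * adjN (cliqueOn S) w u = 0 := by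
      by_contra hne
      simp only [mul_eq_zero, not_or, ← ne_eq, adjN_ne_zero] at hne
      obtain ⟨⟨a, b⟩, c⟩ := hne
      exact hS ⟨a.2.1, a.2.2, b.2.2⟩
    rw [h1, h2]

lemma qFour_core {V : Type*} [Fintype V] {G : SimpleGraph V} {S : Finset V}
    (h : CliqueCore G S) : qFour G = qFour (cliqueOn S) := by
  refine Finset.sum_congr rfl fun u _ => Finset.sum_congr rfl fun v _ =>
    Finset.sum_congr rfl fun w _ => Finset.sum_congr rfl fun x _ => ?_
  split_ifs with hne
  swap
  · rfl
  obtain ⟨n1, n2⟩ := hne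
  by_cases hS : u ∈ S ∧ v ∈ S ∧ w ∈ S ∧ x ∈ S
  · obtain ⟨a, b, c, d⟩ := hS
    rw [adjN_cliqueOn h a b, adjN_cliqueOn h b c, adjN_cliqueOn h c d, adjN_cliqueOn h d a]
  · have h1 : adjN G u v * adjN G v w * adjN G w x * adjN G x u = 0 := by
      by_contra hne
      simp only [mul_eq_zero, not_or, ← ne_eq, adjN_ne_zero] at hne
      obtain ⟨⟨⟨a, b⟩, c⟩, d⟩ := hne
      exact hS ⟨h.quad _ _ _ _ a b c d n1 n2, h.quad _ _ _ _ b c d a n2 n1.symm,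
        h.quad _ _ _ _ c d a b n1.symm n2.symm, h.quad _ _ _ _ d a b c n2.symm n1⟩
    have h2 : adjN (cliqueOn S) u v * adjN (cliqueOn S) v w * adjN (cliqueOn S) w x *
        adjN (cliqueOn S) x u = 0 := by
      by_contra hne
      simp only [mul_eq_zero, not_or, ← ne_eq, adjN_ne_zero] at hne
      obtain ⟨⟨⟨a, b⟩, c⟩, d⟩ := hne
      exact hS ⟨a.2.1, a.2.2, b.2.2, c.2.2⟩
    rw [h1, h2]

lemma exists_equiv_color {V ι : Type*} [Fintype V] [DecidableEq ι] (f g : V → ι)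
    (h : ∀ i, (Finset.univ.filter (fun x => f x = i)).card =
      (Finset.univ.filter (fun x => g x = i)).card) :
    ∃ σ : V ≃ V, ∀ x, g (σ x) = f x := by
  have e : ∀ i, Nonempty ({x // f x = i} ≃ {x // g x = i}) := by
    intro i
    refine ⟨Fintype.equivOfCardEq ?_⟩
    rw [Fintype.card_subtype, Fintype.card_subtype, h i]
  have e := fun i => (e i).some
  refine ⟨(Equiv.sigmaFiberEquiv f).symm.trans
    ((Equiv.sigmaCongrRight e).trans (Equiv.sigmaFiberEquiv g)), fun x => ?_⟩
  exact (e (f x) ⟨x, rfl⟩).2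

lemma exists_equiv_finset {V : Type*} [Fintype V] [DecidableEq V] (S T : Finset V)
    (h : S.card = T.card) : ∃ σ : V ≃ V, ∀ x, σ x ∈ T ↔ x ∈ S := by
  obtain ⟨σ, hσ⟩ := exists_equiv_color (fun x => decide (x ∈ S)) (fun x => decide (x ∈ T)) (by
    intro i
    cases i
    · have a := Finset.card_compl S
      have b := Finset.card_compl T
      simp only [decide_eq_false_iff_not]
      rw [Finset.filter_not, Finset.filter_not]
      simp [Finset.card_sdiff, h]
    · simp [h])
  exact ⟨σ, fun x => by simpa using hσ x⟩

lemma clique_counts {V : Type*} [Fintype V] (S T : Finset V) (h : S.card = T.card) :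
    mThree (cliqueOn S) = mThree (cliqueOn T) ∧ qFour (cliqueOn S) = qFour (cliqueOn T) := by
  classical
  obtain ⟨σ, hσ⟩ := exists_equiv_finset S T h
  have ha : ∀ u v, adjN (cliqueOn S) u v = adjN (cliqueOn T) (σ u) (σ v) := by
    intro u v
    apply adjN_congr
    simp [cliqueOn, hσ]
  constructor
  · refine Fintype.sum_equiv σ _ _ fun u => Fintype.sum_equiv σ _ _ fun v =>
      Fintype.sum_equiv σ _ _ fun w => ?_
    simp only [ha]
  · refine Fintype.sum_equiv σ _ _ fun u => Fintype.sum_equiv σ _ _ fun v =>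
      Fintype.sum_equiv σ _ _ fun w => Fintype.sum_equiv σ _ _ fun x => ?_
    simp only [ha, ne_eq, σ.injective.eq_iff]

/-- Excess degree data. -/
structure Excess {V : Type*} [Fintype V] (G : SimpleGraph V) (S : Finset V) (s : ℕ) (e : V → ℕ) :
    Prop where
  ins : ∀ v ∈ S, dg G v = s + e v
  out : ∀ v, v ∉ S → dg G v = 1 + e v

lemma Excess.sum_dg {V : Type*} [Fintype V] [DecidableEq V] {G : SimpleGraph V} {S : Finset V}
    {s : ℕ} {e : V → ℕ}
    (h : Excess G S s e) : ∑ v, dg G v = S.card * s + Sᶜ.card + ∑ v, e v := by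
  rw [← Finset.sum_add_sum_compl S (dg G), ← Finset.sum_add_sum_compl S e,
    Finset.sum_congr rfl h.ins, Finset.sum_congr rfl (fun v hv => h.out v (Finset.mem_compl.1 hv))]
  simp only [Finset.sum_add_distrib, Finset.sum_const, smul_eq_mul]
  ring

lemma Excess.sum_sq {V : Type*} [Fintype V] [DecidableEq V] {G : SimpleGraph V} {S : Finset V}
    {s : ℕ} {e : V → ℕ} (h : Excess G S s e) :
    ∑ v, dg G v ^ 2 = S.card * s ^ 2 + Sᶜ.card + 2 * (s * ∑ v ∈ S, e v + ∑ v ∈ Sᶜ, e v) +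
      ∑ v, e v ^ 2 := by
  rw [← Finset.sum_add_sum_compl S (fun v => dg G v ^ 2),
    ← Finset.sum_add_sum_compl S (fun v => e v ^ 2),
    Finset.sum_congr rfl (fun v hv => by rw [h.ins v hv]),
    Finset.sum_congr (s₁ := Sᶜ) rfl (fun v hv => by rw [h.out v (Finset.mem_compl.1 hv)])]
  have h1 : ∀ x, (s + e x) ^ 2 = s ^ 2 + (2 * s) * e x + e x ^ 2 := by intro x; ring
  have h2 : ∀ x, (1 + e x) ^ 2 = 1 + 2 * e x + e x ^ 2 := by intro x; ring
  simp only [h1, h2, Finset.sum_add_distrib, Finset.sum_const, smul_eq_mul, ← Finset.mul_sum]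
  ring

/-- Comparison of two clique-core graphs. -/
lemma SLt_of_core {n : ℕ} (hn : 5 ≤ n) {G H : SimpleGraph (Fin n)} {S T : Finset (Fin n)}
    {s : ℕ} {e f : Fin n → ℕ} (hG : CliqueCore G S) (hH : CliqueCore H T) (hc : S.card = T.card)
    (he : Excess G S s e) (hf : Excess H T s f) (hsum : ∑ v, e v = ∑ v, f v)
    (hlt : 2 * (s * ∑ v ∈ S, e v + ∑ v ∈ Sᶜ, e v) + ∑ v, e v ^ 2 <
      2 * (s * ∑ v ∈ T, f v + ∑ v ∈ Tᶜ, f v) + ∑ v, f v ^ 2) : SLt n G H := by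
  have hcc : Sᶜ.card = Tᶜ.card := by rw [Finset.card_compl, Finset.card_compl, hc]
  have h2 : ∑ v, dg G v = ∑ v, dg H v := by rw [he.sum_dg, hf.sum_dg, hc, hcc, hsum]
  obtain ⟨c3, c4⟩ := clique_counts S T hc
  have h3 : mThree G = mThree H := by rw [mThree_core hG, mThree_core hH, c3]
  have h4 : qFour G = qFour H := by rw [qFour_core hG, qFour_core hH, c4]
  have hsq : ∑ v, dg G v ^ 2 < ∑ v, dg H v ^ 2 := by
    rw [he.sum_sq, hf.sum_sq, hc, hcc]; linarith
  have hm : mFour G < mFour H := by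
    have a := mFour_eq G
    have b := mFour_eq H
    omega
  refine ⟨4, by norm_num, by omega, ?_, ?_⟩
  · intro i hi
    interval_cases i
    · rw [spec_zero, spec_zero]
    · rw [spec_one, spec_one]
    · rw [spec_two, spec_two, h2]
    · rw [spec_three, spec_three, h3]
  · rw [spec_four, spec_four]; exact_mod_cast hm

lemma SLt_of_edges {n : ℕ} (hn : 5 ≤ n) {G H : SimpleGraph (Fin n)}
    (h : ∑ v, dg G v < ∑ v, dg H v) : SLt n G H := by
  refine ⟨2, by norm_num, by omega, ?_, ?_⟩
  · intro i hi
    interval_cases i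
    · rw [spec_zero, spec_zero]
    · rw [spec_one, spec_one]
  · rw [spec_two, spec_two]; exact_mod_cast h

lemma core_of_pendant {V : Type*} {G : SimpleGraph V} {S : Finset V}
    (h1 : ∀ u ∈ S, ∀ v ∈ S, u ≠ v → G.Adj u v)
    (h2 : ∀ u, u ∉ S → ∀ v w, G.Adj u v → G.Adj u w → v = w) : CliqueCore G S where
  clique := h1
  tri u v w a b c := by
    by_contra hu
    exact b.ne (h2 u hu _ _ a c.symm)
  quad u v w x a b c d n1 n2 := by
    by_contra hu
    exact n2 (h2 u hu _ _ a d.symm)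

/-! ### Elementary sums -/

lemma sq_conc {V : Type*} (T : Finset V) (e : V → ℕ) (r : ℕ) (hr : 1 ≤ r)
    (h : ∑ v ∈ T, e v = r) : (∃ v ∈ T, e v = r) ∨ ∑ v ∈ T, e v ^ 2 < r ^ 2 := by
  by_cases hv : ∃ v ∈ T, e v = r
  · exact Or.inl hv
  right
  push Not at hv
  have hb : ∀ v ∈ T, e v ^ 2 ≤ (r - 1) * e v := by
    intro v hvT
    have h1 : e v ≤ r := h ▸ Finset.single_le_sum (f := e) (fun _ _ => Nat.zero_le _) hvT
    have h2 := hv v hvT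
    rw [sq]
    exact Nat.mul_le_mul_right _ (by omega)
  have := Finset.sum_le_sum hb
  rw [← Finset.mul_sum, h] at this
  obtain ⟨t, rfl⟩ : ∃ t, r = t + 1 := ⟨r - 1, by omega⟩
  simp only [Nat.add_sub_cancel] at this
  nlinarith

lemma sq_le_conc {V : Type*} (T : Finset V) (e : V → ℕ) (r : ℕ) 
    (h : ∑ v ∈ T, e v = r) : ∑ v ∈ T, e v ^ 2 ≤ r ^ 2 := by
  have hb : ∀ v ∈ T, e v ^ 2 ≤ r * e v := by
    intro v hvT
    have h1 : e v ≤ r := h ▸ Finset.single_le_sum (f := e) (fun _ _ => Nat.zero_le _) hvT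
    rw [sq]
    exact Nat.mul_le_mul_right _ (by omega)
  have := Finset.sum_le_sum hb
  rw [← Finset.mul_sum, h] at this
  rwa [sq]

lemma sq_two_conc {V : Type*} [Fintype V] [DecidableEq V] (e : V → ℕ) (k : ℕ) (hk : 2 ≤ k)
    (h : ∑ v, e v = k) (hno : ¬ ∃ u, e u = k) :
    ∑ v, e v ^ 2 ≤ (k - 1) ^ 2 + 1 ∧
    ((∃ u v, u ≠ v ∧ e u = k - 1 ∧ e v = 1) ∨ ∑ v, e v ^ 2 < (k - 1) ^ 2 + 1) := by
  have hex : ∃ u, 1 ≤ e u := by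
    by_contra hc
    push Not at hc
    have : ∑ v, e v = 0 := Finset.sum_eq_zero fun v _ => by have := hc v; omega
    omega
  obtain ⟨u, hu⟩ := hex
  have hsplit := Finset.add_sum_erase Finset.univ e (Finset.mem_univ u)
  have hsplit2 := Finset.add_sum_erase Finset.univ (fun v => e v ^ 2) (Finset.mem_univ u)
  have hne : e u ≠ k := fun hh => hno ⟨u, hh⟩
  obtain ⟨M, hM⟩ : ∃ M, e u = M + 1 := ⟨e u - 1, by omega⟩
  obtain ⟨r, hr⟩ : ∃ r, ∑ v ∈ Finset.univ.erase u, e v = r + 1 :=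
    ⟨∑ v ∈ Finset.univ.erase u, e v - 1, by omega⟩
  have hkk : k = M + r + 2 := by omega
  have hle := sq_le_conc _ _ _ hr
  have hcase := sq_conc _ _ _ (by omega) hr
  rw [← hsplit2, hM]
  have hk1 : k - 1 = M + r + 1 := by omega
  rw [hk1]
  constructor
  · nlinarith [Nat.zero_le (M * r)]
  rcases hcase with ⟨v, hv, hev⟩ | hlt
  · have huv : v ≠ u := Finset.ne_of_mem_erase hv
    by_cases hM0 : M = 0
    · left; exact ⟨v, u, huv, by omega, by omega⟩
    by_cases hr0 : r = 0
    · left; exact ⟨u, v, huv.symm, by omega, by omega⟩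
    right
    have : 1 ≤ M * r := Nat.mul_pos (by omega) (by omega)
    nlinarith
  · right
    nlinarith [Nat.zero_le (M * r)]

/-! ### Components after deleting bridges -/

lemma card_comp_delete {V : Type*} [Fintype V] (G : SimpleGraph V) (B : Finset (Sym2 V))
    (hB : ∀ e ∈ B, G.IsBridge e ∧ e ∈ G.edgeSet) :
    Nat.card G.ConnectedComponent + B.card ≤
      Nat.card (G.deleteEdges (B : Set (Sym2 V))).ConnectedComponent := by
  classical
  induction B using Finset.induction_on with
  | empty => simp
  | insert e B heB ih =>
    have ih' := ih (fun f hf => hB f (Finset.mem_insert_of_mem hf))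
    obtain ⟨hb, he⟩ := hB e (Finset.mem_insert_self _ _)
    set G' := G.deleteEdges (B : Set (Sym2 V)) with hG'
    have hdel : G.deleteEdges ((insert e B : Finset (Sym2 V)) : Set (Sym2 V)) =
        G'.deleteEdges {e} := by
      rw [hG', deleteEdges_deleteEdges, Finset.coe_insert, Set.insert_eq, Set.union_comm]
    rw [hdel, Finset.card_insert_of_notMem heB]
    have hb' : G'.IsBridge e := hb.anti (deleteEdges_le _)
    have he' : e ∈ G'.edgeSet := by
      rw [hG', edgeSet_deleteEdges]; exact ⟨he, by simpa using heB⟩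
    have hlt : Nat.card G'.ConnectedComponent <
        Nat.card (G'.deleteEdges {e}).ConnectedComponent := by
      have hle : G'.deleteEdges {e} ≤ G' := deleteEdges_le _
      rw [Nat.card_eq_fintype_card, Nat.card_eq_fintype_card]
      refine Fintype.card_lt_of_surjective_not_injective
        (ConnectedComponent.map (Hom.ofLE hle)) ?_ ?_
      · intro c
        induction c using ConnectedComponent.ind with
        | h v => exact ⟨(G'.deleteEdges {e}).connectedComponentMk v, rfl⟩
      · intro hinj
        induction e using Sym2.ind with
        | h u v =>
          rw [isBridge_iff] at hb'
          apply hb'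
          apply ConnectedComponent.exact
          apply hinj
          exact ConnectedComponent.sound (Adj.reachable he')
    omega

lemma clique_of_comps {V : Type*} [Fintype V] (H : SimpleGraph V) (c k : ℕ)
    (hc : 2 ≤ c) (hn : Fintype.card V = c + k)
    (hcomp : k + 1 ≤ Nat.card H.ConnectedComponent) :
    ∑ v, dg H v ≤ c * (c - 1) ∧ (c * (c - 1) ≤ ∑ v, dg H v →
      ∃ S : Finset V, S.card = c ∧ ∀ u v, H.Adj u v ↔ u ≠ v ∧ u ∈ S ∧ v ∈ S) := by
  classical
  rw [Nat.card_eq_fintype_card] at hcomp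
  set mk := H.connectedComponentMk with hmk
  let F : H.ConnectedComponent → Finset V := fun q => Finset.univ.filter (fun v => mk v = q)
  have hFpos : ∀ q, 1 ≤ (F q).card := by
    intro q
    induction q using ConnectedComponent.ind with
    | h v => exact Finset.card_pos.2 ⟨v, by simp [F, hmk]⟩
  let m : H.ConnectedComponent → ℕ := fun q => (F q).card - 1
  have hm : ∀ q, (F q).card = m q + 1 := fun q => by have := hFpos q; simp only [m]; omega
  have hsumF : ∑ q, (F q).card = c + k := by
    rw [← hn, ← Finset.card_univ]
    exact (Finset.card_eq_sum_card_fiberwise (fun x _ => Finset.mem_univ (mk x))).symm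
  have hsumm : ∑ q, m q + Fintype.card H.ConnectedComponent = c + k := by
    rw [← hsumF]; simp only [hm, Finset.sum_add_distrib]; simp
  have hmle : ∀ q, m q ≤ c - 1 := by
    intro q
    have : m q ≤ ∑ q, m q := Finset.single_le_sum (f := m) (fun _ _ => Nat.zero_le _) (Finset.mem_univ q)
    omega
  have hsub : ∀ v, Finset.univ.filter (fun w => H.Adj v w) ⊆ (F (mk v)).erase v := by
    intro v w hw
    simp only [Finset.mem_filter, Finset.mem_univ, true_and] at hw
    simp only [Finset.mem_erase, F, Finset.mem_filter, Finset.mem_univ, true_and]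
    exact ⟨hw.ne.symm, ConnectedComponent.sound hw.symm.reachable⟩
  have hcarderase : ∀ v, ((F (mk v)).erase v).card = m (mk v) := by
    intro v
    rw [Finset.card_erase_of_mem (by simp [F])]
  have hdg : ∀ v, dg H v ≤ m (mk v) := by
    intro v
    rw [dg_eq_card, ← hcarderase v]
    exact Finset.card_le_card (hsub v)
  have hfib : ∑ v, m (mk v) = ∑ q, (m q + 1) * m q := by
    rw [← Finset.sum_fiberwise Finset.univ mk]
    refine Finset.sum_congr rfl fun q _ => ?_
    rw [← hm q, ← smul_eq_mul, ← Finset.sum_const]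
    refine Finset.sum_congr rfl fun v hv => ?_
    rw [(Finset.mem_filter.1 hv).2]
  have hA : ∑ v, dg H v ≤ ∑ v, m (mk v) := Finset.sum_le_sum fun v _ => hdg v
  have hBq : ∀ q ∈ Finset.univ, (m q + 1) * m q ≤ c * m q := by
    intro q _
    exact Nat.mul_le_mul_right _ (by have := hmle q; omega)
  have hB : ∑ q, (m q + 1) * m q ≤ ∑ q, c * m q := Finset.sum_le_sum hBq
  have hC : ∑ q, c * m q ≤ c * (c - 1) := by
    rw [← Finset.mul_sum]
    exact Nat.mul_le_mul_left _ (by omega)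
  refine ⟨by omega, fun hge => ?_⟩
  have eA : ∑ v, dg H v = ∑ v, m (mk v) := by omega
  have eB : ∑ q, (m q + 1) * m q = ∑ q, c * m q := by omega
  have eC : ∑ q, c * m q = c * (c - 1) := by omega
  rw [← Finset.mul_sum] at eC
  have eM : ∑ q, m q = c - 1 := Nat.eq_of_mul_eq_mul_left (by omega) eC
  have eA' := (Finset.sum_eq_sum_iff_of_le (fun v _ => hdg v)).1 eA
  have eB' := (Finset.sum_eq_sum_iff_of_le hBq).1 eB
  have hex : ∃ q, m q ≠ 0 := by
    by_contra hcon
    push Not at hcon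
    have : ∑ q, m q = 0 := Finset.sum_eq_zero fun q _ => hcon q
    omega
  obtain ⟨q0, hq0⟩ := hex
  have hq0c : m q0 + 1 = c :=
    Nat.eq_of_mul_eq_mul_right (Nat.pos_of_ne_zero hq0) (eB' q0 (Finset.mem_univ _))
  have hother : ∀ q, q ≠ q0 → m q = 0 := by
    intro q hq
    have h1 := Finset.add_sum_erase Finset.univ m (Finset.mem_univ q0)
    have h2 : m q ≤ ∑ x ∈ Finset.univ.erase q0, m x :=
      Finset.single_le_sum (f := m) (fun _ _ => Nat.zero_le _)
        (Finset.mem_erase.2 ⟨hq, Finset.mem_univ q⟩)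
    omega
  refine ⟨F q0, by rw [hm, hq0c], fun u v => ?_⟩
  have hadj : ∀ u v, H.Adj u v ↔ v ≠ u ∧ mk v = mk u := by
    intro u v
    have heq : Finset.univ.filter (fun w => H.Adj u w) = (F (mk u)).erase u := by
      apply Finset.eq_of_subset_of_card_le (hsub u)
      rw [hcarderase, ← dg_eq_card, eA' u (Finset.mem_univ _)]
    have := Finset.ext_iff.1 heq v
    simpa [F] using this
  rw [hadj]
  simp only [F, Finset.mem_filter, Finset.mem_univ, true_and]
  constructor
  · rintro ⟨hne, hvu⟩
    have : mk u = q0 := by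
      by_contra hcon
      have h0 := hother _ hcon
      have h1 := hm (mk u)
      rw [h0, zero_add, Finset.card_eq_one] at h1
      obtain ⟨x, hx⟩ := h1
      have hu : u ∈ F (mk u) := by simp [F]
      have hv : v ∈ F (mk u) := by simp [F, hvu]
      rw [hx, Finset.mem_singleton] at hu hv
      exact hne (hv.trans hu.symm)
    exact ⟨hne.symm, this, hvu.trans this⟩
  · rintro ⟨hne, hu, hv⟩
    exact ⟨hne.symm, hv.trans hu.symm⟩

lemma sum_dg_edges {V : Type*} [Fintype V] (G : SimpleGraph V) :
    ∑ v, dg G v = 2 * G.edgeSet.ncard := by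
  classical
  have h := G.sum_degrees_eq_twice_card_edges
  have h2 : G.edgeSet.ncard = G.edgeFinset.card := by
    rw [← coe_edgeFinset, Set.ncard_coe_finset]
  rw [h2, ← h]
  refine Finset.sum_congr rfl fun v _ => ?_
  rw [dg_eq_card, ← card_neighborFinset_eq_degree]
  congr 1
  ext w
  simp

/-- Structure of connected graphs with `k` bridges. -/
lemma bridge_structure {V : Type*} [Fintype V] (G : SimpleGraph V) (c k : ℕ)
    (hc : 2 ≤ c) (hn : Fintype.card V = c + k) (hG : G.Connected) (hk : numBridges G = k) :
    ∑ v, dg G v < c * (c - 1) + 2 * k ∨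
    (∑ v, dg G v = c * (c - 1) + 2 * k ∧ ∃ S : Finset V, S.card = c ∧ CliqueCore G S) := by
  classical
  have hedge : ∀ e, G.IsBridge e → e ∈ G.edgeSet := by
    intro e he
    induction e using Sym2.ind with
    | h u v => exact he.reachable_iff_adj.1 (hG.preconnected u v)
  let B : Finset (Sym2 V) := Finset.univ.filter (fun e => G.IsBridge e)
  have hBset : (B : Set (Sym2 V)) = {e : Sym2 V | G.IsBridge e} := by ext; simp [B]
  have hBcard : B.card = k := by
    rw [← hk, numBridges, ← hBset, Set.ncard_coe_finset]
  set H := G.deleteEdges (B : Set (Sym2 V)) with hH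
  have hcomp : k + 1 ≤ Nat.card H.ConnectedComponent := by
    have h1 := card_comp_delete G B (fun e he => by
      have : G.IsBridge e := by simpa [B] using he
      exact ⟨this, hedge e this⟩)
    change _ ≤ Nat.card H.ConnectedComponent at h1
    have h2 : 1 ≤ Nat.card G.ConnectedComponent := by
      obtain ⟨v⟩ := hG.nonempty
      rw [Nat.card_eq_fintype_card]
      exact Fintype.card_pos_iff.2 ⟨G.connectedComponentMk v⟩
    omega
  have hsum : ∑ v, dg G v = ∑ v, dg H v + 2 * k := by
    rw [sum_dg_edges, sum_dg_edges, hH, edgeSet_deleteEdges]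
    have hsub : (B : Set (Sym2 V)) ⊆ G.edgeSet := by
      intro e he
      exact hedge e (by rw [hBset] at he; exact he)
    have := Set.ncard_sdiff_add_ncard_of_subset hsub (Set.toFinite _)
    rw [Set.ncard_coe_finset, hBcard] at this
    omega
  obtain ⟨hle, heq⟩ := clique_of_comps H c k hc hn hcomp
  by_cases hlt : ∑ v, dg H v < c * (c - 1)
  · left; omega
  right
  obtain ⟨S, hS, hadj⟩ := heq (by omega)
  refine ⟨by omega, S, hS, ?_⟩
  have hHadj : ∀ u v, H.Adj u v ↔ G.Adj u v ∧ ¬ G.IsBridge s(u, v) := by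
    intro u v
    rw [hH, deleteEdges_adj, hBset]; rfl
  have hin : ∀ u v, G.Adj u v → (G.deleteEdges {s(u, v)}).Reachable u v → u ∈ S := by
    intro u v huv hr
    have : H.Adj u v := (hHadj u v).2 ⟨huv, by rw [isBridge_iff]; exact not_not.2 hr⟩
    exact ((hadj u v).1 this).2.1
  refine ⟨fun u hu v hv hne => ?_, fun u v w a b d => ?_, fun u v w x a b d f n1 n2 => ?_⟩
  · exact ((hHadj u v).1 ((hadj u v).2 ⟨hne, hu, hv⟩)).1
  · apply hin u v a
    have h1 : (G.deleteEdges {s(u, v)}).Adj u w := by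
      rw [deleteEdges_adj]; refine ⟨d.symm, ?_⟩
      have := a.ne; have := b.ne; have := d.ne
      simp; grind
    have h2 : (G.deleteEdges {s(u, v)}).Adj w v := by
      rw [deleteEdges_adj]; refine ⟨b.symm, ?_⟩
      have := a.ne; have := b.ne; have := d.ne
      simp; grind
    exact h1.reachable.trans h2.reachable
  · apply hin u v a
    have := a.ne; have := b.ne; have := d.ne; have := f.ne
    have h1 : (G.deleteEdges {s(u, v)}).Adj u x := by
      rw [deleteEdges_adj]; refine ⟨f.symm, ?_⟩
      simp; grind
    have h2 : (G.deleteEdges {s(u, v)}).Adj x w := by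
      rw [deleteEdges_adj]; refine ⟨d.symm, ?_⟩
      simp; grind
    have h3 : (G.deleteEdges {s(u, v)}).Adj w v := by
      rw [deleteEdges_adj]; refine ⟨b.symm, ?_⟩
      simp; grind
    exact (h1.reachable.trans h2.reachable).trans h3.reachable

/-! ### Shapes of the extremal graphs -/

/-- A clique with all the pendant vertices at one vertex. -/
structure StarForm {V : Type*} (G : SimpleGraph V) (S : Finset V) (u : V) : Prop where
  hu : u ∈ S
  clique : ∀ x ∈ S, ∀ y ∈ S, x ≠ y → G.Adj x y
  pend : ∀ x, x ∉ S → ∀ y, G.Adj x y ↔ y = u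

/-- A clique with all the pendant vertices but `w` at `u`, and `w` at `v`. -/
structure TwoForm {V : Type*} (G : SimpleGraph V) (S : Finset V) (u v w : V) : Prop where
  hu : u ∈ S
  hv : v ∈ S
  hw : w ∉ S
  huv : u ≠ v
  clique : ∀ x ∈ S, ∀ y ∈ S, x ≠ y → G.Adj x y
  pend : ∀ x, x ∉ S → x ≠ w → ∀ y, G.Adj x y ↔ y = u
  pendw : ∀ y, G.Adj w y ↔ y = v

lemma StarForm.adj_iff {V : Type*} {G : SimpleGraph V} {S : Finset V} {u : V}
    (h : StarForm G S u) (x y : V) : G.Adj x y ↔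
      (x ≠ y ∧ x ∈ S ∧ y ∈ S) ∨ (x ∉ S ∧ y = u) ∨ (y ∉ S ∧ x = u) := by
  have hc := h.clique x
  have h1 := h.pend x
  have h2 := h.pend y
  have h3 := G.adj_comm x y
  have h4 : G.Adj x y → x ≠ y := Adj.ne
  have h5 := h.hu
  by_cases hx : x ∈ S <;> by_cases hy : y ∈ S
  · exact ⟨fun a => Or.inl ⟨h4 a, hx, hy⟩, fun a => hc hx y hy (by grind)⟩
  · rw [h3, h2 hy]; grind
  · rw [h1 hx]; grind
  · rw [h1 hx]; grind

lemma TwoForm.adj_iff {V : Type*} {G : SimpleGraph V} {S : Finset V} {u v w : V}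
    (h : TwoForm G S u v w) (x y : V) : G.Adj x y ↔
      (x ≠ y ∧ x ∈ S ∧ y ∈ S) ∨ (x ∉ S ∧ x ≠ w ∧ y = u) ∨ (y ∉ S ∧ y ≠ w ∧ x = u) ∨
      (x = w ∧ y = v) ∨ (y = w ∧ x = v) := by
  have hc := h.clique x
  have h1 := h.pend x
  have h2 := h.pend y
  have h3 := G.adj_comm x y
  have h4 : G.Adj x y → x ≠ y := Adj.ne
  have h5 := h.hu
  have h6 := h.hv
  have h7 := h.hw
  have h8 := h.pendw
  by_cases hx : x ∈ S <;> by_cases hy : y ∈ S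
  · have : G.Adj x y ↔ x ≠ y := ⟨h4, hc hx y hy⟩
    rw [this]; grind
  · by_cases hyw : y = w
    · rw [h3, hyw, h8]; grind
    · rw [h3, h2 hy hyw]; grind
  · by_cases hxw : x = w
    · rw [hxw, h8]; grind
    · rw [h1 hx hxw]; grind
  · by_cases hxw : x = w
    · rw [hxw, h8]; grind
    · rw [h1 hx hxw]; grind

lemma equiv_fix {V : Type*} [DecidableEq V] {S T : Finset V} (σ : V ≃ V)
    (hσ : ∀ x, σ x ∈ T ↔ x ∈ S) (a b : V) (hab : a ∈ S ↔ b ∈ T) :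
    ∃ τ : V ≃ V, (∀ x, τ x ∈ T ↔ x ∈ S) ∧ τ a = b ∧ ∀ x, x ≠ a → σ x ≠ b → τ x = σ x := by
  refine ⟨σ.trans (Equiv.swap (σ a) b), ?_, by simp, ?_⟩
  · intro x
    simp only [Equiv.trans_apply, Equiv.swap_apply_def]
    have h1 := hσ x
    have h2 := hσ a
    have h3 : σ x = σ a → x = a := fun h => σ.injective h
    grind
  · intro x hx hb
    simp only [Equiv.trans_apply]
    exact Equiv.swap_apply_of_ne_of_ne (fun h => hx (σ.injective h)) hb

lemma StarForm.iso {V : Type*} [Fintype V] {G H : SimpleGraph V} {S T : Finset V} {u z : V}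
    (h : StarForm G S u) (h' : StarForm H T z) (hc : S.card = T.card) : Nonempty (G ≃g H) := by
  classical
  obtain ⟨σ, hσ⟩ := exists_equiv_finset S T hc
  obtain ⟨τ, h1, h2, -⟩ := equiv_fix σ hσ u z (by simp [h.hu, h'.hu])
  refine ⟨⟨τ, ?_⟩⟩
  intro x y
  have e : ∀ x, τ x = z ↔ x = u := fun x => by rw [← h2]; exact τ.injective.eq_iff
  have i : τ x = τ y ↔ x = y := τ.injective.eq_iff
  rw [h.adj_iff, h'.adj_iff, h1, h1, e, e, ne_eq, i]

lemma TwoForm.iso {V : Type*} [Fintype V] {G H : SimpleGraph V} {S T : Finset V}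
    {u v w u' v' w' : V}
    (h : TwoForm G S u v w) (h' : TwoForm H T u' v' w') (hc : S.card = T.card) :
    Nonempty (G ≃g H) := by
  classical
  obtain ⟨σ, hσ⟩ := exists_equiv_finset S T hc
  obtain ⟨σ1, h1, a1, -⟩ := equiv_fix σ hσ u u' (by simp [h.hu, h'.hu])
  obtain ⟨σ2, h2, a2, b2⟩ := equiv_fix σ1 h1 v v' (by simp [h.hv, h'.hv])
  have a1' : σ2 u = u' := by
    rw [b2 u h.huv (by rw [a1]; exact h'.huv), a1]
  obtain ⟨τ, h3, a3, b3⟩ := equiv_fix σ2 h2 w w' (by simp [h.hw, h'.hw])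
  have eu : τ u = u' := by
    rw [b3 u (fun hh => h.hw (hh ▸ h.hu)) (by rw [a1']; exact fun hh => h'.hw (hh ▸ h'.hu)), a1']
  have ev : τ v = v' := by
    rw [b3 v (fun hh => h.hw (hh ▸ h.hv)) (by rw [a2]; exact fun hh => h'.hw (hh ▸ h'.hv)), a2]
  refine ⟨⟨τ, ?_⟩⟩
  intro x y
  have e1 : ∀ x, τ x = u' ↔ x = u := fun x => by rw [← eu]; exact τ.injective.eq_iff
  have e2 : ∀ x, τ x = v' ↔ x = v := fun x => by rw [← ev]; exact τ.injective.eq_iff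
  have e3 : ∀ x, τ x = w' ↔ x = w := fun x => by rw [← a3]; exact τ.injective.eq_iff
  have i : τ x = τ y ↔ x = y := τ.injective.eq_iff
  rw [h.adj_iff, h'.adj_iff]
  simp only [h3, e1, e2, e3, ne_eq, i]

open Classical in
/-- Number of neighbours outside `S`. -/
noncomputable def outDeg {V : Type*} [Fintype V] (G : SimpleGraph V) (S : Finset V) (v : V) : ℕ :=
  (Finset.univ.filter (fun w => G.Adj v w ∧ w ∉ S)).card

lemma dg_clique {V : Type*} [Fintype V] {G : SimpleGraph V} {S : Finset V}
    (hc : ∀ x ∈ S, ∀ y ∈ S, x ≠ y → G.Adj x y) {v : V} (hv : v ∈ S) :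
    dg G v = (S.card - 1) + outDeg G S v := by
  classical
  rw [dg_eq_card, outDeg, ← Finset.card_erase_of_mem hv, ← Finset.card_union_of_disjoint]
  · congr 1
    ext w
    simp only [Finset.mem_filter, Finset.mem_univ, true_and, Finset.mem_union, Finset.mem_erase]
    constructor
    · intro a
      by_cases hw : w ∈ S
      · exact Or.inl ⟨a.ne.symm, hw⟩
      · exact Or.inr ⟨a, hw⟩
    · rintro (⟨a, b⟩ | ⟨a, -⟩)
      · exact hc v hv w b a.symm
      · exact a
  · rw [Finset.disjoint_left]
    intro a ha hb
    exact (Finset.mem_filter.1 hb).2.2 (Finset.mem_of_mem_erase ha)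

lemma dg_single {V : Type*} [Fintype V] {G : SimpleGraph V} {x u : V}
    (h : ∀ y, G.Adj x y ↔ y = u) : dg G x = 1 := by
  classical
  rw [dg_eq_card, Finset.card_eq_one]
  exact ⟨u, by ext y; simp [h]⟩

lemma StarForm.core {V : Type*} {G : SimpleGraph V} {S : Finset V} {u : V}
    (h : StarForm G S u) : CliqueCore G S :=
  core_of_pendant h.clique fun x hx v w a b => by
    rw [(h.pend x hx v).1 a, (h.pend x hx w).1 b]

lemma TwoForm.core {V : Type*} {G : SimpleGraph V} {S : Finset V} {u v w : V}
    (h : TwoForm G S u v w) : CliqueCore G S :=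
  core_of_pendant h.clique fun x hx a b ha hb => by
    by_cases hxw : x = w
    · subst hxw
      rw [(h.pendw a).1 ha, (h.pendw b).1 hb]
    · rw [(h.pend x hx hxw a).1 ha, (h.pend x hx hxw b).1 hb]

lemma StarForm.excess {V : Type*} [Fintype V] [DecidableEq V] {G : SimpleGraph V} {S : Finset V}
    {u : V} (h : StarForm G S u) :
    Excess G S (S.card - 1) (fun x => if x = u then Sᶜ.card else 0) where
  ins x hx := by
    rw [dg_clique h.clique hx, outDeg]
    congr 1
    split_ifs with hxu
    · congr 1
      ext y
      simp only [Finset.mem_filter, Finset.mem_univ, true_and, Finset.mem_compl, h.adj_iff]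
      grind
    · rw [Finset.card_eq_zero]
      ext y
      simp only [Finset.mem_filter, Finset.mem_univ, true_and, Finset.notMem_empty, h.adj_iff]
      grind
  out x hx := by
    have : x ≠ u := fun hh => hx (hh ▸ h.hu)
    rw [dg_single (h.pend x hx)]
    simp [this]

lemma TwoForm.excess {V : Type*} [Fintype V] [DecidableEq V] {G : SimpleGraph V} {S : Finset V}
    {u v w : V} (h : TwoForm G S u v w) :
    Excess G S (S.card - 1)
      (fun x => (if x = u then Sᶜ.card - 1 else 0) + (if x = v then 1 else 0)) where
  ins x hx := by
    have h1 := h.hu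
    have h2 := h.hv
    have h3 := h.hw
    have h4 := h.huv
    rw [dg_clique h.clique hx, outDeg]
    congr 1
    by_cases hxu : x = u
    · have hxv : x ≠ v := hxu ▸ h4
      simp only [hxu, h4, if_true, if_false, add_zero]
      rw [← Finset.card_erase_of_mem (s := Sᶜ) (a := w) (by simpa using h3)]
      congr 1
      ext y
      simp only [Finset.mem_filter, Finset.mem_univ, true_and, Finset.mem_compl, h.adj_iff,
        Finset.mem_erase]
      grind
    · by_cases hxv : x = v
      · simp only [hxv, h4.symm, if_true, if_false, zero_add]
        rw [Finset.card_eq_one]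
        refine ⟨w, ?_⟩
        ext y
        simp only [Finset.mem_filter, Finset.mem_univ, true_and, Finset.mem_singleton, h.adj_iff]
        grind
      · simp only [hxu, hxv, if_false, add_zero]
        rw [Finset.card_eq_zero]
        ext y
        simp only [Finset.mem_filter, Finset.mem_univ, true_and, Finset.notMem_empty, h.adj_iff]
        grind
  out x hx := by
    have h1 : x ≠ u := fun hh => hx (hh ▸ h.hu)
    have h2 : x ≠ v := fun hh => hx (hh ▸ h.hv)
    have : dg G x = 1 := by
      by_cases hxw : x = w
      · subst hxw; exact dg_single h.pendw
      · exact dg_single (h.pend x hx hxw)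
    rw [this]
    simp [h1, h2]

lemma KnK_form (n k : ℕ) (hn : k + 3 ≤ n) :
    StarForm (KnK n k) (Finset.univ.filter (fun i : Fin n => (i : ℕ) < n - k))
      ⟨0, by omega⟩ where
  hu := by simp; omega
  clique x hx y hy hne := by
    simp only [Finset.mem_filter, Finset.mem_univ, true_and] at hx hy
    simp only [KnK, fromRel_adj]
    exact ⟨hne, by omega⟩
  pend x hx y := by
    simp only [Finset.mem_filter, Finset.mem_univ, true_and] at hx
    simp only [KnK, fromRel_adj, ne_eq, Fin.ext_iff]
    omega

lemma GThree_form (n k : ℕ) (hk : 2 ≤ k) (hn : k + 3 ≤ n) :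
    TwoForm (GThree n k) (Finset.univ.filter (fun i : Fin n => (i : ℕ) < n - k))
      ⟨0, by omega⟩ ⟨1, by omega⟩ ⟨n - 1, by omega⟩ where
  hu := by simp; omega
  hv := by simp; omega
  hw := by simp; omega
  huv := by simp
  clique x hx y hy hne := by
    simp only [Finset.mem_filter, Finset.mem_univ, true_and] at hx hy
    simp only [GThree, fromRel_adj]
    exact ⟨hne, by omega⟩
  pend x hx hxw y := by
    simp only [Finset.mem_filter, Finset.mem_univ, true_and] at hx
    simp only [GThree, fromRel_adj, ne_eq, Fin.ext_iff] at hxw ⊢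
    omega
  pendw y := by
    simp only [GThree, fromRel_adj, ne_eq, Fin.ext_iff, and_true]
    omega

lemma boundary_edge {V : Type*} {G : SimpleGraph V} (hG : G.Connected) (P : Set V) {a b : V}
    (ha : a ∈ P) (hb : b ∉ P) : ∃ x ∈ P, ∃ y, y ∉ P ∧ G.Adj x y := by
  obtain ⟨p⟩ := hG.preconnected a b
  obtain ⟨d, -, h1, h2⟩ := p.exists_boundary_dart P ha hb
  exact ⟨d.fst, h1, d.snd, h2, d.adj⟩

/-- Main comparison for graphs with the maximal number of edges. -/
lemma main_core {V : Type*} [Fintype V] [DecidableEq V] {G : SimpleGraph V} {S : Finset V}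
    {c k : ℕ} (hc : 3 ≤ c) (hk : 2 ≤ k) (hn : Fintype.card V = c + k) (hG : G.Connected)
    (hsum : ∑ v, dg G v = c * (c - 1) + 2 * k) (hS : S.card = c) (hcore : CliqueCore G S) :
    (∃ u, StarForm G S u) ∨ (∃ u v w, TwoForm G S u v w) ∨
    ∃ e, Excess G S (c - 1) e ∧ ∑ v, e v = k ∧
      2 * ((c - 1) * ∑ v ∈ S, e v + ∑ v ∈ Sᶜ, e v) + ∑ v, e v ^ 2 <
        2 * ((c - 1) * k) + ((k - 1) ^ 2 + 1) := by
  let e : V → ℕ := fun v => if v ∈ S then outDeg G S v else dg G v - 1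
  have hSc : Sᶜ.card = k := by rw [Finset.card_compl]; omega
  obtain ⟨s0, hs0⟩ : S.Nonempty := Finset.card_pos.1 (by omega)
  obtain ⟨t0, ht0⟩ : Sᶜ.Nonempty := Finset.card_pos.1 (by omega)
  rw [Finset.mem_compl] at ht0
  have hdpos : ∀ v, v ∉ S → 1 ≤ dg G v := by
    intro v hv
    obtain ⟨x, hx, y, -, hxy⟩ := boundary_edge hG {v} (a := v) (b := s0) rfl
      (fun hh => hv (by rw [Set.mem_singleton_iff] at hh; exact hh ▸ hs0))
    rw [Set.mem_singleton_iff] at hx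
    subst hx
    rw [dg_eq_card]
    exact Finset.card_pos.2 ⟨y, by simpa using hxy⟩
  have hex : Excess G S (c - 1) e := by
    constructor
    · intro v hv
      rw [dg_clique hcore.clique hv, hS]; simp [e, hv]
    · intro v hv
      have := hdpos v hv
      simp only [e, hv, if_false]; omega
  have hek : ∑ v, e v = k := by
    have := hex.sum_dg
    rw [hsum, hS, hSc] at this
    omega
  have hout : ∀ x ∈ S, ∀ y, y ∉ S → G.Adj x y → 1 ≤ e x := by
    intro x hx y hy a
    simp only [e, hx, if_true, outDeg]
    exact Finset.card_pos.2 ⟨y, by simp [a, hy]⟩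
  have hSpos : 1 ≤ ∑ v ∈ S, e v := by
    obtain ⟨x, hx, y, hy, hxy⟩ := boundary_edge hG (S : Set V) (a := s0) (b := t0)
      (by simpa using hs0) (by simpa using ht0)
    have h1 := hout x (by simpa using hx) y (by simpa using hy) hxy
    exact h1.trans (Finset.single_le_sum (f := e) (fun _ _ => Nat.zero_le _) (by simpa using hx))
  have hsplit := Finset.sum_add_sum_compl S e
  rw [hek] at hsplit
  by_cases hz : ∑ v ∈ Sᶜ, e v = 0
  swap
  · -- some tree vertex is not a leaf
    right; right
    refine ⟨e, hex, hek, ?_⟩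
    have hno : ¬ ∃ u, e u = k := by
      rintro ⟨u, hu⟩
      by_cases huS : u ∈ S
      · have := Finset.single_le_sum (f := e) (fun _ _ => Nat.zero_le _) huS
        omega
      · have := Finset.single_le_sum (f := e) (fun _ _ => Nat.zero_le _) (Finset.mem_compl.2 huS)
        omega
    have hsq := (sq_two_conc e k hk hek hno).1
    have : (c - 1) * ∑ v ∈ S, e v + ∑ v ∈ Sᶜ, e v < (c - 1) * k := by
      rw [← hsplit, mul_add]
      have : 2 * ∑ v ∈ Sᶜ, e v ≤ (c - 1) * ∑ v ∈ Sᶜ, e v := Nat.mul_le_mul_right _ (by omega)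
      omega
    omega
  -- all tree vertices are leaves
  have hzero : ∀ v, v ∉ S → dg G v = 1 := by
    intro v hv
    have := (Finset.sum_eq_zero_iff.1 hz) v (Finset.mem_compl.2 hv)
    rw [hex.out v hv, this, add_zero]
  have hnb : ∀ v, v ∉ S → ∃ y, ∀ z, G.Adj v z ↔ z = y := by
    intro v hv
    have h1 := hzero v hv
    rw [dg_eq_card, Finset.card_eq_one] at h1
    obtain ⟨y, hy⟩ := h1
    refine ⟨y, fun z => ?_⟩
    have := Finset.ext_iff.1 hy z
    simpa using this
  have hnbS : ∀ v, v ∉ S → ∃ y ∈ S, ∀ z, G.Adj v z ↔ z = y := by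
    intro v hv
    obtain ⟨y, hy⟩ := hnb v hv
    refine ⟨y, ?_, hy⟩
    by_contra hyS
    obtain ⟨y', hy'⟩ := hnb y hyS
    have hyv : v = y' := (hy' v).1 ((hy y).2 rfl).symm
    obtain ⟨a, ha, b, hb, hab⟩ := boundary_edge hG {v, y} (a := v) (b := s0) (by simp)
      (by rintro (h | h)
          · exact hv (h ▸ hs0)
          · rw [Set.mem_singleton_iff] at h; exact hyS (h ▸ hs0))
    rcases ha with h | h
    · subst h
      exact hb (Or.inr ((hy b).1 hab))
    · rw [Set.mem_singleton_iff] at h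
      subst h
      exact hb (Or.inl (((hy' b).1 hab).trans hyv.symm))
  have hone : ∀ u, e u ≠ 0 → u ∈ S := by
    intro u hu
    by_contra huS
    exact hu ((Finset.sum_eq_zero_iff.1 hz) u (Finset.mem_compl.2 huS))
  by_cases hno : ∃ u, e u = k
  · obtain ⟨u, hu⟩ := hno
    left
    refine ⟨u, hone u (by omega), hcore.clique, ?_⟩
    intro x hx y
    obtain ⟨p, hpS, hp⟩ := hnbS x hx
    have hpe := hout p hpS x hx ((hp p).2 rfl).symm
    have : p = u := by
      by_contra hpu
      have h1 := Finset.add_sum_erase Finset.univ e (Finset.mem_univ u)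
      have h2 := Finset.single_le_sum (f := e) (fun _ _ => Nat.zero_le _)
        (Finset.mem_erase.2 ⟨hpu, Finset.mem_univ p⟩)
      omega
    rw [hp y, this]
  right
  rcases (sq_two_conc e k hk hek hno).2 with ⟨u, v, huv, hu, hv⟩ | hlt
  swap
  · right
    refine ⟨e, hex, hek, ?_⟩
    have : ∑ v ∈ S, e v = k := by omega
    rw [hz, this]; omega
  left
  have huS : u ∈ S := hone u (by omega)
  have hvS : v ∈ S := hone v (by omega)
  have hvo : outDeg G S v = 1 := by rw [← hv]; simp [e, hvS]
  rw [outDeg, Finset.card_eq_one] at hvo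
  obtain ⟨w, hw⟩ := hvo
  have hw' : ∀ y, (G.Adj v y ∧ y ∉ S) ↔ y = w := by
    intro y
    have := Finset.ext_iff.1 hw y
    simpa using this
  obtain ⟨hvw, hwS⟩ := (hw' w).2 rfl
  refine ⟨u, v, w, huS, hvS, hwS, huv, hcore.clique, ?_, ?_⟩
  · intro x hx hxw y
    obtain ⟨p, hpS, hp⟩ := hnbS x hx
    have hxp := (hp p).2 rfl
    have hpe := hout p hpS x hx hxp.symm
    have hpv : p ≠ v := by
      rintro rfl
      exact hxw ((hw' x).1 ⟨hxp.symm, hx⟩)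
    have : p = u := by
      by_contra hpu
      have h1 := Finset.add_sum_erase Finset.univ e (Finset.mem_univ u)
      have h3 := Finset.add_sum_erase (Finset.univ.erase u) e (a := v)
        (Finset.mem_erase.2 ⟨huv.symm, Finset.mem_univ v⟩)
      have h2 := Finset.single_le_sum (f := e) (s := (Finset.univ.erase u).erase v)
        (fun _ _ => Nat.zero_le _)
        (Finset.mem_erase.2 ⟨hpv, Finset.mem_erase.2 ⟨hpu, Finset.mem_univ p⟩⟩)
      omega
    rw [hp y, this]
  · intro y
    obtain ⟨p, hpS, hp⟩ := hnbS w hwS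
    have : v = p := (hp v).1 hvw.symm
    rw [hp y, this]

/-- Among connected graphs with `n` vertices and `k` cut edges (`2 ≤ k ≤ n - 3`),
the second last graph in the `S`-order is obtained uniquely at `G_3`. -/
theorem second_last_in_S_order (n k : ℕ) (hk2 : 2 ≤ k) (hk : k ≤ n - 3) :
    SLt n (GThree n k) (KnK n k) ∧
    ∀ G : SimpleGraph (Fin n), G.Connected → numBridges G = k →
      ¬ Nonempty (G ≃g KnK n k) → ¬ Nonempty (G ≃g GThree n k) →
      SLt n G (GThree n k) := by
  have hn : k + 3 ≤ n := by omega
  have hKf := KnK_form n k hn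
  have hGf := GThree_form n k hk2 hn
  set T : Finset (Fin n) := Finset.univ.filter (fun i : Fin n => (i : ℕ) < n - k) with hT
  have hTc : T.card = n - k := by
    rw [hT, Fin.card_filter_val_lt]
    omega
  have hTcc : Tᶜ.card = k := by
    rw [Finset.card_compl, hTc, Fintype.card_fin]; omega
  have hKe := hKf.excess
  have hGe := hGf.excess
  rw [hTc, hTcc] at hKe hGe
  set z : Fin n := ⟨0, by omega⟩ with hz
  set o : Fin n := ⟨1, by omega⟩ with ho
  have hzo : z ≠ o := hGf.huv
  have hzT : z ∈ T := hGf.hu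
  have hoT : o ∈ T := hGf.hv
  set f : Fin n → ℕ := fun x => (if x = z then k - 1 else 0) + (if x = o then 1 else 0) with hf
  have fT : ∑ v ∈ T, f v = k := by
    simp [hf, Finset.sum_add_distrib, hzT, hoT]; omega
  have fA : ∑ v, f v = k := by
    simp [hf, Finset.sum_add_distrib]; omega
  have fC : ∑ v ∈ Tᶜ, f v = 0 := by
    have := Finset.sum_add_sum_compl T f
    omega
  have fS : ∑ v, f v ^ 2 = (k - 1) ^ 2 + 1 := by
    have : ∀ v, f v ^ 2 = (if v = z then (k - 1) ^ 2 else 0) + (if v = o then 1 else 0) := by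
      intro v
      by_cases h1 : v = z
      · simp [hf, h1, hzo]
      · by_cases h2 : v = o <;> simp [hf, h1, h2, hzo.symm]
    simp [this, Finset.sum_add_distrib]
  refine ⟨?_, ?_⟩
  · refine SLt_of_core (by omega) hGf.core hKf.core rfl hGe hKe ?_ ?_
    · rw [fA]; simp
    · rw [fT, fC, fS]
      have h1 : ∑ v ∈ T, (if v = z then k else 0) = k := by simp [hzT]
      have h2 : ∑ v ∈ Tᶜ, (if v = z then k else 0) = 0 := by simp [hzT]
      have h3 : ∑ v, (if v = z then k else 0) ^ 2 = k ^ 2 := by simp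
      rw [h1, h2, h3]
      obtain ⟨t, rfl⟩ : ∃ t, k = t + 2 := ⟨k - 2, by omega⟩
      have : t + 2 - 1 = t + 1 := by omega
      rw [this]
      nlinarith
  · intro G hG hb hnK hnG
    have hcard : Fintype.card (Fin n) = (n - k) + k := by rw [Fintype.card_fin]; omega
    have hsumG : ∑ v, dg (GThree n k) v = (n - k) * (n - k - 1) + 2 * k := by
      rw [hGe.sum_dg, fA, hTc, hTcc]; ring
    rcases bridge_structure G (n - k) k (by omega) hcard hG hb with hlt | ⟨heq, S, hS, hcore⟩
    · exact SLt_of_edges (by omega) (by rw [hsumG]; exact hlt)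
    · rcases main_core (by omega) hk2 hcard hG heq hS hcore with
        ⟨u, hu⟩ | ⟨u, v, w, hu⟩ | ⟨e, he, hek, hlt⟩
      · exact absurd (hu.iso hKf (hS.trans hTc.symm)) hnK
      · exact absurd (hu.iso hGf (hS.trans hTc.symm)) hnG
      · refine SLt_of_core (by omega) hcore hGf.core (hS.trans hTc.symm) he hGe
          (hek.trans fA.symm) ?_
        rw [fT, fC, fS]
        omega
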